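/- arXiv:2105.07835 — 2 statements merged into one kernel-verified Lean document; each statement's English description precedes it below -/
import Mathlib

section
/- Let (𝒳, 𝒜, λ) be a probability space, d_V, D, N ∈ ℕ, δ > 0. Let 𝒢 assign to every θ ∈ ℝ^D a bounded measurable function 𝒢(θ) : 𝒳 → ℝ^{d_V}, let g★ : 𝒳 → ℝ^{d_V} be bounded measurable, and let I : ℝ^D → ℝ be any function. Fix data points (y_i, x_i) ∈ ℝ^{d_V} × 𝒳 for i = 1,…,N, and a point θ' ∈ ℝ^D. If θ̂ ∈ ℝ^D maximizes θ ↦ −(1/(2N)) Σ_{i=1}^N |y_i − 𝒢(θ)(x_i)|² − δ²·I(θ) over ℝ^D, then (1/2) ∫_𝒳 |𝒢(θ̂)(x) − g★(x)|² dλ(x) + δ²·I(θ̂) ≤ [ (1/N) Σ_{i=1}^N ( log p_{𝒢(θ̂)} − log p_{𝒢(θ')} )(y_i, x_i) − ∫_{ℝ^{d_V}×𝒳} ( log p_{𝒢(θ̂)} − log p_{𝒢(θ')} ) dP_{g★} ] + δ²·I(θ') + (1/2) ∫_𝒳 |𝒢(θ')(x) − g★(x)|² dλ(x). -/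
open MeasureTheory

/-- The Gaussian regression density
`p_g(y,x) = (2π)^{−d_V/2}·exp(−|y − g(x)|²/2)` on `ℝ^{d_V} × 𝒳`. -/
noncomputable def pdens {𝒳 : Type*} (dV : ℕ) (g : 𝒳 → EuclideanSpace ℝ (Fin dV))
    (w : EuclideanSpace ℝ (Fin dV) × 𝒳) : ℝ :=
  (2 * Real.pi) ^ (-(dV : ℝ) / 2) * Real.exp (-‖w.1 - g w.2‖ ^ 2 / 2)

/-- The law `P_g` on `ℝ^{d_V} × 𝒳` of `(Y, X)` where `X ∼ λ` and `Y = g(X) + ε` with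
standard Gaussian noise `ε`; it has density `p_g` with respect to `dy ⊗ dλ`. -/
noncomputable def obsLaw {𝒳 : Type*} [MeasurableSpace 𝒳] (dV : ℕ) (μ : Measure 𝒳)
    (g : 𝒳 → EuclideanSpace ℝ (Fin dV)) : Measure (EuclideanSpace ℝ (Fin dV) × 𝒳) :=
  ((volume : Measure (EuclideanSpace ℝ (Fin dV))).prod μ).withDensity
    fun w => ENNReal.ofReal (pdens dV g w)

/-- The logarithm of the Gaussian regression density. -/
theorem log_pdens {𝒳 : Type*} (dV : ℕ) (g : 𝒳 → EuclideanSpace ℝ (Fin dV))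
    (w : EuclideanSpace ℝ (Fin dV) × 𝒳) :
    Real.log (pdens dV g w) =
      Real.log ((2 * Real.pi) ^ (-(dV : ℝ) / 2)) - ‖w.1 - g w.2‖ ^ 2 / 2 := by
  have h : (0 : ℝ) < (2 * Real.pi) ^ (-(dV : ℝ) / 2) := by positivity
  rw [pdens, Real.log_mul h.ne' (Real.exp_pos _).ne', Real.log_exp]
  ring

theorem pdens_nonneg {𝒳 : Type*} (dV : ℕ) (g : 𝒳 → EuclideanSpace ℝ (Fin dV))
    (w : EuclideanSpace ℝ (Fin dV) × 𝒳) : 0 ≤ pdens dV g w := by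
  unfold pdens
  positivity

theorem measurable_pdens {𝒳 : Type*} [MeasurableSpace 𝒳] (dV : ℕ)
    {g : 𝒳 → EuclideanSpace ℝ (Fin dV)} (hg : Measurable g) : Measurable (pdens dV g) := by
  unfold pdens
  fun_prop

theorem integrable_exp_neg_mul_sq_norm {V : Type*} [NormedAddCommGroup V]
    [InnerProductSpace ℝ V] [FiniteDimensional ℝ V] [MeasurableSpace V] [BorelSpace V]
    {b : ℝ} (hb : 0 < b) : Integrable fun v : V => Real.exp (-b * ‖v‖ ^ 2) := by
  apply Integrable.of_integral_ne_zero
  rw [GaussianFourier.integral_rexp_neg_mul_sq_norm hb]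
  positivity

theorem exp_neg_sq_norm_sub_mul_le {V : Type*} [NormedAddCommGroup V] {M : ℝ} {m : V}
    (hm : ‖m‖ ≤ M) (y : V) :
    Real.exp (-‖y - m‖ ^ 2 / 2) * (1 + ‖y‖) ≤
      3 * Real.exp (M ^ 2 / 2) * Real.exp (-(1 / 8) * ‖y‖ ^ 2) := by
  have h1 : 1 + ‖y‖ ≤ 3 * Real.exp (‖y‖ ^ 2 / 8) := by
    nlinarith [Real.add_one_le_exp (‖y‖ ^ 2 / 8), sq_nonneg (‖y‖ - 4), sq_nonneg ‖y‖]
  have h2 : ‖y‖ ^ 2 ≤ 2 * ‖y - m‖ ^ 2 + 2 * M ^ 2 := by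
    have h3 : ‖y‖ ≤ ‖y - m‖ + M := by
      calc ‖y‖ = ‖(y - m) + m‖ := by simp
        _ ≤ ‖y - m‖ + ‖m‖ := norm_add_le _ _
        _ ≤ _ := by gcongr
    nlinarith [sq_nonneg (‖y - m‖ - M), norm_nonneg y]
  calc Real.exp (-‖y - m‖ ^ 2 / 2) * (1 + ‖y‖)
      ≤ Real.exp (M ^ 2 / 2 - ‖y‖ ^ 2 / 4) * (3 * Real.exp (‖y‖ ^ 2 / 8)) := by
        gcongr
        linarith
    _ = 3 * Real.exp (M ^ 2 / 2) * Real.exp (-(1 / 8) * ‖y‖ ^ 2) := by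
        rw [mul_left_comm, ← Real.exp_add, mul_assoc, ← Real.exp_add]
        ring_nf

theorem half_sq_norm_sub_sub_half_sq_norm_sub {V : Type*} [NormedAddCommGroup V]
    [InnerProductSpace ℝ V] (y a b : V) :
    ‖y - a‖ ^ 2 / 2 - ‖y - b‖ ^ 2 / 2 = ‖a‖ ^ 2 / 2 - ‖b‖ ^ 2 / 2 + inner ℝ y (b - a) := by
  rw [norm_sub_sq_real, norm_sub_sq_real, inner_sub_right]
  ring

theorem abs_half_sq_norm_sub_sub_le {V : Type*} [NormedAddCommGroup V]
    [InnerProductSpace ℝ V] {A B : ℝ} {a b : V} (ha : ‖a‖ ≤ A) (hb : ‖b‖ ≤ B) (y : V) :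
    |‖y - a‖ ^ 2 / 2 - ‖y - b‖ ^ 2 / 2| ≤ (A ^ 2 + B ^ 2 + A + B) * (1 + ‖y‖) := by
  have hA : 0 ≤ A := (norm_nonneg a).trans ha
  have hB : 0 ≤ B := (norm_nonneg b).trans hb
  have h1 : |inner ℝ y (b - a)| ≤ ‖y‖ * (A + B) := by
    refine (abs_real_inner_le_norm _ _).trans ?_
    gcongr
    linarith [norm_sub_le b a]
  have h2 : ‖a‖ ^ 2 ≤ A ^ 2 := by gcongr
  have h3 : ‖b‖ ^ 2 ≤ B ^ 2 := by gcongr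
  rw [half_sq_norm_sub_sub_half_sq_norm_sub]
  have hy := norm_nonneg y
  have h4 : 0 ≤ (A ^ 2 + B ^ 2) * ‖y‖ := by positivity
  rw [abs_le] at h1 ⊢
  constructor <;> nlinarith [sq_nonneg ‖a‖, sq_nonneg ‖b‖]

/-- The mean of a difference of squared distances under a Gaussian with identity covariance. -/
theorem integral_gaussian_mul_sq_norm_sub (dV : ℕ) (m a b : EuclideanSpace ℝ (Fin dV)) :
    ∫ y : EuclideanSpace ℝ (Fin dV),
      (2 * Real.pi) ^ (-(dV : ℝ) / 2) * Real.exp (-‖y - m‖ ^ 2 / 2) *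
        (‖y - a‖ ^ 2 / 2 - ‖y - b‖ ^ 2 / 2) = ‖m - a‖ ^ 2 / 2 - ‖m - b‖ ^ 2 / 2 := by
  set c : ℝ := (2 * Real.pi) ^ (-(dV : ℝ) / 2) with hc
  have hexp : ∀ e : EuclideanSpace ℝ (Fin dV),
      Real.exp (-‖e‖ ^ 2 / 2) = Real.exp (-(1 / 2) * ‖e‖ ^ 2) := fun e => by ring_nf
  have hi1 : Integrable fun e : EuclideanSpace ℝ (Fin dV) => Real.exp (-‖e‖ ^ 2 / 2) := by
    simp_rw [hexp]
    exact integrable_exp_neg_mul_sq_norm (by norm_num)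
  have hi2 : Integrable fun e : EuclideanSpace ℝ (Fin dV) =>
      Real.exp (-‖e‖ ^ 2 / 2) * inner ℝ e (b - a) := by
    refine Integrable.mono' (((integrable_exp_neg_mul_sq_norm (b := 1 / 8)
      (by norm_num)).const_mul (3 * Real.exp (0 ^ 2 / 2))).mul_const ‖b - a‖) (by fun_prop) ?_
    refine Filter.Eventually.of_forall fun e => ?_
    have h := exp_neg_sq_norm_sub_mul_le (M := 0) (m := (0 : EuclideanSpace ℝ (Fin dV)))
      (by simp) e
    rw [sub_zero] at h
    refine le_trans ?_ (mul_le_mul_of_nonneg_right h (norm_nonneg _))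
    rw [norm_mul, Real.norm_eq_abs, Real.abs_exp, mul_assoc]
    gcongr
    refine (norm_inner_le_norm _ _).trans ?_
    gcongr
    linarith
  have hodd : ∫ e : EuclideanSpace ℝ (Fin dV),
      Real.exp (-‖e‖ ^ 2 / 2) * inner ℝ e (b - a) = 0 := by
    have h := integral_neg_eq_self (fun e : EuclideanSpace ℝ (Fin dV) =>
      Real.exp (-‖e‖ ^ 2 / 2) * inner ℝ e (b - a)) volume
    simp only [norm_neg, inner_neg_left, mul_neg, integral_neg] at h
    linarith
  have hone : c * ∫ e : EuclideanSpace ℝ (Fin dV), Real.exp (-‖e‖ ^ 2 / 2) = 1 := by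
    simp_rw [hexp]
    rw [GaussianFourier.integral_rexp_neg_mul_sq_norm (by norm_num), hc,
      finrank_euclideanSpace_fin, show Real.pi / (1 / 2) = 2 * Real.pi by ring,
      ← Real.rpow_add (by positivity)]
    ring_nf
    simp
  rw [← integral_add_right_eq_self _ m]
  calc _ = ∫ e : EuclideanSpace ℝ (Fin dV),
        (c * (‖m - a‖ ^ 2 / 2 - ‖m - b‖ ^ 2 / 2) * Real.exp (-‖e‖ ^ 2 / 2) +
          c * (Real.exp (-‖e‖ ^ 2 / 2) * inner ℝ e (b - a))) := by
        congr 1 with e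
        have h := half_sq_norm_sub_sub_half_sq_norm_sub e (a - m) (b - m)
        rw [show e - (a - m) = e + m - a by abel, show e - (b - m) = e + m - b by abel,
          norm_sub_rev a, norm_sub_rev b, sub_sub_sub_cancel_right] at h
        rw [h, add_sub_cancel_right]
        ring
    _ = _ := by
        rw [integral_add (hi1.const_mul _) (hi2.const_mul _), integral_const_mul,
          integral_const_mul, hodd, mul_right_comm, hone]
        ring

/-- The expected log-likelihood ratio of two Gaussian regression models. -/
theorem integral_log_pdens_sub_obsLaw {𝒳 : Type*} [MeasurableSpace 𝒳] (μ : Measure 𝒳)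
    [IsFiniteMeasure μ] (dV : ℕ) {g a b : 𝒳 → EuclideanSpace ℝ (Fin dV)}
    (hg : Measurable g) (ha : Measurable a) (hb : Measurable b)
    (hgb : ∃ M : ℝ, ∀ x, ‖g x‖ ≤ M) (hab : ∃ M : ℝ, ∀ x, ‖a x‖ ≤ M)
    (hbb : ∃ M : ℝ, ∀ x, ‖b x‖ ≤ M) :
    ∫ w, (Real.log (pdens dV b w) - Real.log (pdens dV a w)) ∂(obsLaw dV μ g) =
      ∫ x, (‖g x - a x‖ ^ 2 / 2 - ‖g x - b x‖ ^ 2 / 2) ∂μ := by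
  obtain ⟨M, hM⟩ := hgb
  obtain ⟨A, hA⟩ := hab
  obtain ⟨B, hB⟩ := hbb
  rw [obsLaw, integral_withDensity_eq_integral_toReal_smul
    (measurable_pdens dV hg).ennreal_ofReal (Filter.Eventually.of_forall fun _ =>
      ENNReal.ofReal_lt_top)]
  have hlog : ∀ w : EuclideanSpace ℝ (Fin dV) × 𝒳,
      (ENNReal.ofReal (pdens dV g w)).toReal •
        (Real.log (pdens dV b w) - Real.log (pdens dV a w)) =
      (2 * Real.pi) ^ (-(dV : ℝ) / 2) * Real.exp (-‖w.1 - g w.2‖ ^ 2 / 2) *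
        (‖w.1 - a w.2‖ ^ 2 / 2 - ‖w.1 - b w.2‖ ^ 2 / 2) := fun w => by
    rw [ENNReal.toReal_ofReal (pdens_nonneg dV g w), log_pdens, log_pdens, smul_eq_mul, pdens]
    ring
  simp_rw [hlog]
  rw [integral_prod_symm]
  · simp_rw [integral_gaussian_mul_sq_norm_sub]
  refine Integrable.mono' ((((integrable_exp_neg_mul_sq_norm (b := 1 / 8)
      (by norm_num)).const_mul (3 * Real.exp (M ^ 2 / 2))).const_mul
        ((2 * Real.pi) ^ (-(dV : ℝ) / 2) * (A ^ 2 + B ^ 2 + A + B))).comp_fst μ)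
    (Measurable.aestronglyMeasurable (by fun_prop)) ?_
  refine Filter.Eventually.of_forall fun w => ?_
  have hA0 : 0 ≤ A := (norm_nonneg _).trans (hA w.2)
  have hB0 : 0 ≤ B := (norm_nonneg _).trans (hB w.2)
  have hc : (0 : ℝ) < (2 * Real.pi) ^ (-(dV : ℝ) / 2) := by positivity
  refine le_trans ?_ (mul_le_mul_of_nonneg_left (exp_neg_sq_norm_sub_mul_le (hM w.2) w.1)
    (by positivity))
  rw [norm_mul, norm_mul, Real.norm_eq_abs, Real.norm_eq_abs, Real.norm_eq_abs, Real.abs_exp,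
    abs_of_pos hc]
  calc _ ≤ (2 * Real.pi) ^ (-(dV : ℝ) / 2) * Real.exp (-‖w.1 - g w.2‖ ^ 2 / 2) *
        ((A ^ 2 + B ^ 2 + A + B) * (1 + ‖w.1‖)) := by
        gcongr
        exact abs_half_sq_norm_sub_sub_le (hA w.2) (hB w.2) w.1
    _ = _ := by ring

theorem integrable_sq_norm_sub_of_bounded {𝒳 V : Type*} [MeasurableSpace 𝒳] {μ : Measure 𝒳}
    [IsFiniteMeasure μ] [NormedAddCommGroup V] [MeasurableSpace V] [BorelSpace V]
    [SecondCountableTopology V] {f g : 𝒳 → V} (hf : Measurable f) (hg : Measurable g)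
    (hfb : ∃ M : ℝ, ∀ x, ‖f x‖ ≤ M) (hgb : ∃ M : ℝ, ∀ x, ‖g x‖ ≤ M) :
    Integrable (fun x => ‖f x - g x‖ ^ 2) μ := by
  obtain ⟨A, hA⟩ := hfb
  obtain ⟨B, hB⟩ := hgb
  refine Integrable.of_bound (C := (A + B) ^ 2)
    (Measurable.aestronglyMeasurable (by fun_prop)) (Filter.Eventually.of_forall fun x => ?_)
  rw [norm_pow, norm_norm]
  gcongr
  exact (norm_sub_le _ _).trans (add_le_add (hA x) (hB x))

/-- Lemma 5.1: the basic inequality for any maximizer `θ̂` of the penalized likelihood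
`θ ↦ −(1/(2N)) Σᵢ |yᵢ − 𝒢(θ)(xᵢ)|² − δ²·I(θ)` over `ℝ^D`. -/
theorem stmt5 (𝒳 : Type*) [MeasurableSpace 𝒳] (μ : Measure 𝒳) [IsProbabilityMeasure μ]
    (dV D N : ℕ) (hN : 0 < N) (δ : ℝ) (hδ : 0 < δ)
    (G : (Fin D → ℝ) → 𝒳 → EuclideanSpace ℝ (Fin dV))
    (hGmeas : ∀ θ, Measurable (G θ))
    (hGbdd : ∀ θ, ∃ M : ℝ, ∀ x, ‖G θ x‖ ≤ M)
    (gstar : 𝒳 → EuclideanSpace ℝ (Fin dV))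
    (hgstarm : Measurable gstar) (hgstarb : ∃ M : ℝ, ∀ x, ‖gstar x‖ ≤ M)
    (I : (Fin D → ℝ) → ℝ)
    (data : Fin N → EuclideanSpace ℝ (Fin dV) × 𝒳)
    (θ' θhat : Fin D → ℝ)
    (hmax : ∀ θ : Fin D → ℝ,
      -(1 / (2 * (N : ℝ))) * (∑ i, ‖(data i).1 - G θ (data i).2‖ ^ 2) - δ ^ 2 * I θ ≤
        -(1 / (2 * (N : ℝ))) * (∑ i, ‖(data i).1 - G θhat (data i).2‖ ^ 2) -
          δ ^ 2 * I θhat) :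
    (1 / 2) * (∫ x, ‖G θhat x - gstar x‖ ^ 2 ∂μ) + δ ^ 2 * I θhat ≤
      ((1 / (N : ℝ)) *
          (∑ i, (Real.log (pdens dV (G θhat) (data i)) -
            Real.log (pdens dV (G θ') (data i)))) -
        ∫ w, (Real.log (pdens dV (G θhat) w) - Real.log (pdens dV (G θ') w))
          ∂(obsLaw dV μ gstar)) +
        δ ^ 2 * I θ' + (1 / 2) * ∫ x, ‖G θ' x - gstar x‖ ^ 2 ∂μ := by
  rw [integral_log_pdens_sub_obsLaw μ dV hgstarm (hGmeas θ') (hGmeas θhat) hgstarb (hGbdd θ')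
    (hGbdd θhat)]
  simp_rw [norm_sub_rev (gstar _)]
  rw [integral_sub
    ((integrable_sq_norm_sub_of_bounded (hGmeas θ') hgstarm (hGbdd θ') hgstarb).div_const 2)
    ((integrable_sq_norm_sub_of_bounded (hGmeas θhat) hgstarm (hGbdd θhat) hgstarb).div_const 2),
    integral_div, integral_div]
  have hsum : (1 / (N : ℝ)) * (∑ i, (Real.log (pdens dV (G θhat) (data i)) -
      Real.log (pdens dV (G θ') (data i)))) =
      (1 / (2 * (N : ℝ))) * (∑ i, ‖(data i).1 - G θ' (data i).2‖ ^ 2) -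
        (1 / (2 * (N : ℝ))) * (∑ i, ‖(data i).1 - G θhat (data i).2‖ ^ 2) := by
    simp_rw [log_pdens, sub_sub_sub_cancel_left]
    rw [Finset.sum_sub_distrib, ← Finset.sum_div, ← Finset.sum_div]
    ring
  rw [hsum]
  linarith [hmax θ']
end

section
/- For all integers n ≥ 0 and 0 ≤ k ≤ n and all z ∈ ℂ: (1 − z·conj(z)) · ∂_{z̄} Z_{n,k}(z) = (n − k + 1) · ( z · Z_{n,k}(z) − Z_{n+1,k}(z) ). -/
noncomputable section

open Complex

/-- The Zernike polynomial `Z_{n,k}` (for `0 ≤ k ≤ n`), given by its explicit expansion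
`Z_{n,k}(z) = Σ_{i = max(0, 2k−n)}^{k} (−1)^i (k choose i) ((n−k+i)!/((n−2k+i)!·k!))
  z^{n−2k+i} conj(z)^i`. -/
def ZP (n k : ℕ) (z : ℂ) : ℂ :=
  ∑ i ∈ Finset.Icc (2 * k - n) k,
    (-1 : ℂ) ^ i * (k.choose i : ℂ) *
      ((((n + i - k).factorial / ((n + i - 2 * k).factorial * k.factorial) : ℕ)) : ℂ) *
      z ^ (n + i - 2 * k) * (starRingEnd ℂ z) ^ i

/-- Directional derivative of `f : ℂ → ℂ` in the direction `1` (the derivative `∂_x f`). -/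
def pdx (f : ℂ → ℂ) (z : ℂ) : ℂ := fderiv ℝ f z 1

/-- Directional derivative of `f : ℂ → ℂ` in the direction `i` (the derivative `∂_y f`). -/
def pdy (f : ℂ → ℂ) (z : ℂ) : ℂ := fderiv ℝ f z Complex.I

/-- The Wirtinger derivative `∂_z f = (1/2)(∂_x f − i·∂_y f)`. -/
def wdz (f : ℂ → ℂ) (z : ℂ) : ℂ := (1 / 2 : ℂ) * (pdx f z - Complex.I * pdy f z)

/-- The conjugate Wirtinger derivative `∂_z̄ f = (1/2)(∂_x f + i·∂_y f)`. -/
def wdzbar (f : ℂ → ℂ) (z : ℂ) : ℂ := (1 / 2 : ℂ) * (pdx f z + Complex.I * pdy f z)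

/-- The expansion of `Z_{m+k,k}` with binomial coefficients, over the full range of indices. -/
theorem ZP_add_eq_sum_range (m k : ℕ) (z : ℂ) :
    ZP (m + k) k z = ∑ i ∈ Finset.range (k + 1),
      (-1 : ℂ) ^ i * (k.choose i : ℂ) * ((m + i).choose k : ℂ) *
        z ^ (m + i - k) * (starRingEnd ℂ z) ^ i := by
  unfold ZP
  have hsub : Finset.Icc (2 * k - (m + k)) k ⊆ Finset.range (k + 1) := by
    intro i hi
    simp only [Finset.mem_Icc, Finset.mem_range] at hi ⊢
    omega
  rw [← Finset.sum_subset hsub]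
  · refine Finset.sum_congr rfl fun i hi => ?_
    rw [Finset.mem_Icc] at hi
    have h1 : m + k + i - k = m + i := by omega
    have h2 : m + k + i - 2 * k = m + i - k := by omega
    rw [h1, h2, Nat.choose_eq_factorial_div_factorial (by omega : k ≤ m + i),
      mul_comm k.factorial]
  · intro i hi hi'
    simp only [Finset.mem_Icc, Finset.mem_range] at hi hi'
    rw [Nat.choose_eq_zero_of_lt (by omega : m + i < k)]
    simp

/-- If the real derivative of `f` is `v ↦ p v + q conj(v)`, then `∂_z̄ f = q`. -/
theorem wdzbar_eq_of_hasFDerivAt {f : ℂ → ℂ} {z p q : ℂ}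
    (h : HasFDerivAt f (p • ContinuousLinearMap.id ℝ ℂ + q • (conjCLE : ℂ →L[ℝ] ℂ)) z) :
    wdzbar f z = q := by
  simp only [wdzbar, pdx, pdy, h.fderiv, add_apply,
    smul_apply, ContinuousLinearMap.id_apply, smul_eq_mul,
    ContinuousLinearEquiv.coe_coe, conjCLE_apply, map_one, conj_I]
  linear_combination (p - q) / 2 * I_mul_I

theorem hasFDerivAt_pow_mul_conj_pow (c : ℂ) (a b : ℕ) (z : ℂ) :
    HasFDerivAt (fun w : ℂ => c * w ^ a * (starRingEnd ℂ w) ^ b)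
      ((c * (a * z ^ (a - 1)) * (starRingEnd ℂ z) ^ b) • ContinuousLinearMap.id ℝ ℂ +
        (c * z ^ a * (b * (starRingEnd ℂ z) ^ (b - 1))) • (conjCLE : ℂ →L[ℝ] ℂ)) z := by
  have h1 := (HasFDerivAt.pow (hasFDerivAt_id (𝕜 := ℝ) z) a).const_mul c
  have h2 := HasFDerivAt.pow ((conjCLE : ℂ →L[ℝ] ℂ).hasFDerivAt (x := z)) b
  refine (h1.mul h2).congr_fderiv ?_
  ext v
  all_goals
    simp
    ring

theorem wdzbar_ZP_add (m k : ℕ) (z : ℂ) :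
    wdzbar (ZP (m + k) k) z = ∑ i ∈ Finset.range (k + 1),
      (-1 : ℂ) ^ i * (k.choose i : ℂ) * ((m + i).choose k : ℂ) *
        z ^ (m + i - k) * (i * (starRingEnd ℂ z) ^ (i - 1)) := by
  have h := HasFDerivAt.fun_sum (u := Finset.range (k + 1)) fun i _ =>
    hasFDerivAt_pow_mul_conj_pow
      ((-1 : ℂ) ^ i * (k.choose i : ℂ) * ((m + i).choose k : ℂ)) (m + i - k) i z
  rw [Finset.sum_add_distrib, ← Finset.sum_smul, ← Finset.sum_smul] at h
  rw [funext (ZP_add_eq_sum_range m k)]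
  exact wdzbar_eq_of_hasFDerivAt h

/-- The sum for `∂_z̄ Z_{m+k,k}`, reindexed by the exponent of `conj z`. -/
theorem wdzbar_ZP_add_shift (m k : ℕ) (z : ℂ) :
    wdzbar (ZP (m + k) k) z = ∑ i ∈ Finset.range (k + 1),
      (-1 : ℂ) ^ (i + 1) * (k.choose (i + 1) : ℂ) * ((m + (i + 1)).choose k : ℂ) *
        z ^ (m + (i + 1) - k) * ((i + 1) * (starRingEnd ℂ z) ^ i) := by
  rw [wdzbar_ZP_add, Finset.sum_range_succ', Finset.sum_range_succ]
  simp

theorem choose_recurrence (m k i : ℕ) :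
    ((k : ℂ) - i) * ((m + i + 1).choose k : ℂ) + i * ((m + i).choose k : ℂ) =
      (m + 1) * (((m + i + 1).choose k : ℂ) - ((m + i).choose k : ℂ)) := by
  cases k with
  | zero => simp
  | succ k =>
    have h1 := congrArg (Nat.cast (R := ℂ)) (Nat.add_one_mul_choose_eq (m + i) k)
    have h2 := congrArg (Nat.cast (R := ℂ)) (Nat.choose_succ_succ (m + i) k)
    simp only [Nat.succ_eq_add_one] at h2
    push_cast at h1 h2 ⊢
    linear_combination -h1 - (m + i + 1) * h2

theorem choose_mul_pow_succ (z : ℂ) (m k i : ℕ) :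
    ((m + i).choose k : ℂ) * z ^ (m + i + 1 - k) =
      ((m + i).choose k : ℂ) * (z * z ^ (m + i - k)) := by
  rcases lt_or_ge (m + i) k with h | h
  · simp [Nat.choose_eq_zero_of_lt h]
  · rw [Nat.sub_add_comm h, pow_succ']

theorem natCast_mul_mul_pow_pred (w : ℂ) (i : ℕ) : w * (i * w ^ (i - 1)) = i * w ^ i := by
  cases i with
  | zero => simp
  | succ i => simp only [Nat.add_sub_cancel, pow_succ]; ring

/-- The identity `(1 − z·conj z)·∂_z̄ Z_{n,k} = (n − k + 1)·(z·Z_{n,k} − Z_{n+1,k})`. -/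
theorem stmt14 (n k : ℕ) (hk : k ≤ n) (z : ℂ) :
    (1 - z * starRingEnd ℂ z) * wdzbar (ZP n k) z =
      ((n : ℂ) - (k : ℂ) + 1) * (z * ZP n k z - ZP (n + 1) k z) := by
  obtain ⟨m, rfl⟩ := Nat.exists_eq_add_of_le' hk
  rw [sub_mul, one_mul]
  nth_rewrite 1 [wdzbar_ZP_add_shift]
  rw [wdzbar_ZP_add, show m + k + 1 = (m + 1) + k by omega, ZP_add_eq_sum_range,
    ZP_add_eq_sum_range, Finset.mul_sum, Finset.mul_sum, ← Finset.sum_sub_distrib,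
    ← Finset.sum_sub_distrib, Finset.mul_sum]
  refine Finset.sum_congr rfl fun i hi => ?_
  have hik : i ≤ k := Nat.lt_succ_iff.mp (Finset.mem_range.mp hi)
  have hc := congrArg (Nat.cast (R := ℂ)) (Nat.choose_succ_right_eq k i)
  push_cast [Nat.cast_sub hik] at hc ⊢
  have hr := choose_recurrence m k i
  have hz := choose_mul_pow_succ z m k i
  have hw := natCast_mul_mul_pow_pred (starRingEnd ℂ z) i
  rw [show m + (i + 1) = m + i + 1 by omega, show m + 1 + i = m + i + 1 by omega]
  generalize starRingEnd ℂ z = w at *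
  generalize z ^ (m + i + 1 - k) = P at *
  generalize z ^ (m + i - k) = Q at *
  linear_combination
    (-1 : ℂ) ^ (i + 1) * ((m + i + 1).choose k : ℂ) * P * w ^ i * hc
    - (-1 : ℂ) ^ i * (k.choose i : ℂ) * P * w ^ i * hr
    - (-1 : ℂ) ^ i * (k.choose i : ℂ) * ((m + i).choose k : ℂ) * z * Q * hw
    + (-1 : ℂ) ^ i * (k.choose i : ℂ) * w ^ i * (i + m + 1) * hz
end
end
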